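/- Let R be the ℂ-subalgebra of Maps(M2(ℂ)^4, ℂ) generated by t1, t2, t3, t4, s11, s22, s33, s44, s12, s23, s34, s14. Then the family E = {1, s13, s24, s13·s24} ∪ {s13^k, s13^k·s24, s24^k, s24^k·s13 : k ≥ 2} ∪ {s13^k·s123, s13^k·s134, s24^k·s124, s24^k·s234 : k ≥ 0} of functions on M2(ℂ)^4 is linearly independent over R. -/

import Mathlib

/-- The 2×2 complex matrices. -/
abbrev M2 : Type := Matrix (Fin 2) (Fin 2) ℂ

/-- The traceless part `[[y]] = y - (1/2)·tr(y)·I` of a 2×2 complex matrix. -/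
noncomputable def tl (y : M2) : M2 := y - (Matrix.trace y / 2) • (1 : M2)

/-- The function `t_i` on quadruples of 2×2 matrices: `x ↦ tr(x_i)`.
(Indices are 0-based: `tfun 0` is `t₁`, ..., `tfun 3` is `t₄`.) -/
noncomputable def tfun (i : Fin 4) : (Fin 4 → M2) → ℂ := fun x => Matrix.trace (x i)

/-- The function `s_{ij}` on quadruples of 2×2 matrices: `x ↦ tr([[x_i]]·[[x_j]])`. -/
noncomputable def sfun (i j : Fin 4) : (Fin 4 → M2) → ℂ :=
  fun x => Matrix.trace (tl (x i) * tl (x j))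

/-- The function `s_{ijk}` on quadruples of 2×2 matrices: `x ↦ tr([[x_i]]·[[x_j]]·[[x_k]])`. -/
noncomputable def sfun3 (i j k : Fin 4) : (Fin 4 → M2) → ℂ :=
  fun x => Matrix.trace (tl (x i) * tl (x j) * tl (x k))

/-- The ℂ-subalgebra `T₄` of the algebra of functions `M₂(ℂ)⁴ → ℂ`, generated by the
`t_i` (1 ≤ i ≤ 4), the `s_{ij}` (1 ≤ i ≤ j ≤ 4) and the `s_{ijk}` (1 ≤ i < j < k ≤ 4). -/
noncomputable def T4 : Subalgebra ℂ ((Fin 4 → M2) → ℂ) :=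
  Algebra.adjoin ℂ
    {f | (∃ i, f = tfun i) ∨ (∃ i j, i ≤ j ∧ f = sfun i j) ∨
      (∃ i j k, i < j ∧ j < k ∧ f = sfun3 i j k)}

/-- The ℂ-subalgebra `R` generated by t₁, t₂, t₃, t₄, s₁₁, s₂₂, s₃₃, s₄₄, s₁₂, s₂₃, s₃₄, s₁₄. -/
noncomputable def Ralg : Subalgebra ℂ ((Fin 4 → M2) → ℂ) :=
  Algebra.adjoin ℂ
    {tfun 0, tfun 1, tfun 2, tfun 3, sfun 0 0, sfun 1 1, sfun 2 2, sfun 3 3,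
     sfun 0 1, sfun 1 2, sfun 2 3, sfun 0 3}

/-- The set `E = {1, s₁₃, s₂₄, s₁₃s₂₄} ∪ {s₁₃ᵏ, s₁₃ᵏs₂₄, s₂₄ᵏ, s₂₄ᵏs₁₃ : k ≥ 2}
∪ {s₁₃ᵏs₁₂₃, s₁₃ᵏs₁₃₄, s₂₄ᵏs₁₂₄, s₂₄ᵏs₂₃₄ : k ≥ 0}`. -/
noncomputable def Eset : Set ((Fin 4 → M2) → ℂ) :=
  {1, sfun 0 2, sfun 1 3, sfun 0 2 * sfun 1 3} ∪
  {f | ∃ k : ℕ, 2 ≤ k ∧ (f = sfun 0 2 ^ k ∨ f = sfun 0 2 ^ k * sfun 1 3 ∨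
    f = sfun 1 3 ^ k ∨ f = sfun 1 3 ^ k * sfun 0 2)} ∪
  {f | ∃ k : ℕ, f = sfun 0 2 ^ k * sfun3 0 1 2 ∨ f = sfun 0 2 ^ k * sfun3 0 2 3 ∨
    f = sfun 1 3 ^ k * sfun3 0 1 3 ∨ f = sfun 1 3 ^ k * sfun3 1 2 3}

namespace EIndep

/-- Index type for the family `E`, without repetitions. -/
inductive Idx : Type
  | one : Idx
  | ab : Idx
  | pw : Bool → ℕ → Idx
  | pm : Bool → ℕ → Idx
  | d1 : Bool → ℕ → Idx
  | d2 : Bool → ℕ → Idx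

/-- The family. -/
noncomputable def e : Idx → ((Fin 4 → M2) → ℂ)
  | .one => 1
  | .ab => sfun 0 2 * sfun 1 3
  | .pw false k => sfun 0 2 ^ (k + 1)
  | .pw true k => sfun 1 3 ^ (k + 1)
  | .pm false k => sfun 0 2 ^ (k + 2) * sfun 1 3
  | .pm true k => sfun 1 3 ^ (k + 2) * sfun 0 2
  | .d1 false k => sfun 0 2 ^ k * sfun3 0 1 2
  | .d1 true k => sfun 1 3 ^ k * sfun3 1 2 3
  | .d2 false k => sfun 0 2 ^ k * sfun3 0 2 3
  | .d2 true k => sfun 1 3 ^ k * sfun3 0 1 3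

/-- Order of the pole along the degenerating family. -/
def adeg : Idx → ℕ
  | .one => 0
  | .ab => 1
  | .pw false k => k + 1
  | .pw true _ => 0
  | .pm false k => k + 2
  | .pm true _ => 1
  | .d1 false k => k + 1
  | .d1 true _ => 0
  | .d2 false k => k + 1
  | .d2 true _ => 0

/-- The twelve generators of `R`. -/
noncomputable def gens (x : Fin 4 → M2) : Fin 12 → ℂ :=
  ![tfun 0 x, tfun 1 x, tfun 2 x, tfun 3 x, sfun 0 0 x, sfun 1 1 x, sfun 2 2 x, sfun 3 3 x,
     sfun 0 1 x, sfun 1 2 x, sfun 2 3 x, sfun 0 3 x]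

lemma exists_poly {g : (Fin 4 → M2) → ℂ} (hg : g ∈ Ralg) :
    ∃ p : MvPolynomial (Fin 12) ℂ, ∀ x, g x = MvPolynomial.eval (gens x) p := by
  unfold Ralg at hg
  induction hg using Algebra.adjoin_induction with
  | mem f hf =>
    simp only [Set.mem_insert_iff, Set.mem_singleton_iff] at hf
    rcases hf with h | h | h | h | h | h | h | h | h | h | h | h
    · exact ⟨MvPolynomial.X 0, fun x => by simp [h, gens]⟩
    · exact ⟨MvPolynomial.X 1, fun x => by simp [h, gens]⟩
    · exact ⟨MvPolynomial.X 2, fun x => by simp [h, gens]⟩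
    · exact ⟨MvPolynomial.X 3, fun x => by simp [h, gens]⟩
    · exact ⟨MvPolynomial.X 4, fun x => by simp [h, gens]⟩
    · exact ⟨MvPolynomial.X 5, fun x => by simp [h, gens]⟩
    · exact ⟨MvPolynomial.X 6, fun x => by simp [h, gens]⟩
    · exact ⟨MvPolynomial.X 7, fun x => by simp [h, gens]⟩
    · exact ⟨MvPolynomial.X 8, fun x => by simp [h, gens]⟩
    · exact ⟨MvPolynomial.X 9, fun x => by simp [h, gens]⟩
    · exact ⟨MvPolynomial.X 10, fun x => by simp [h, gens]⟩
    · exact ⟨MvPolynomial.X 11, fun x => by simp [h, gens]⟩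
  | algebraMap r => exact ⟨MvPolynomial.C r, fun x => by simp⟩
  | add f g _ _ hf hg =>
    obtain ⟨p, hp⟩ := hf
    obtain ⟨q, hq⟩ := hg
    exact ⟨p + q, fun x => by simp [hp, hq]⟩
  | mul f g _ _ hf hg =>
    obtain ⟨p, hp⟩ := hf
    obtain ⟨q, hq⟩ := hg
    exact ⟨p * q, fun x => by simp [hp, hq]⟩

/-- The matrix with trace `t` and traceless part `[[p,q],[r,-p]]`. -/
noncomputable def mk (t p q r : ℂ) : M2 := !![t / 2 + p, q; r, t / 2 - p]

lemma tl_mk (t p q r : ℂ) : tl (mk t p q r) = !![p, q; r, -p] := by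
  ext i j
  fin_cases i <;> fin_cases j <;> simp [tl, mk, Matrix.trace_fin_two]

/-- Degenerating family; `w` is the prescribed limit of the generators,
`p2 ^ 2 * 2 = w 5`, `p4 ^ 2 * 2 = w 7`. -/
noncomputable def fam (w : Fin 12 → ℂ) (p2 p4 z : ℂ) : Fin 4 → M2 :=
  ![mk (w 0) 0 z⁻¹ (w 4 / 2 * z), mk (w 1) p2 (w 9) (w 8 * z),
    mk (w 2) 0 (w 6 / 2) 1, mk (w 3) p4 (w 10) (w 11 * z)]

/-- The values of the generators on the family. -/
noncomputable def W (w : Fin 12 → ℂ) (p2 p4 z : ℂ) : Fin 12 → ℂ :=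
  ![w 0, w 1, w 2, w 3, w 4, 2 * p2 ^ 2 + 2 * w 9 * w 8 * z, w 6,
    2 * p4 ^ 2 + 2 * w 10 * w 11 * z,
    w 8 + w 4 / 2 * w 9 * z, w 9 + w 8 * (w 6 / 2) * z, w 10 + w 6 / 2 * w 11 * z,
    w 11 + w 10 * (w 4 / 2) * z]

lemma gens_fam (w : Fin 12 → ℂ) (p2 p4 z : ℂ) (hz : z ≠ 0) :
    gens (fam w p2 p4 z) = W w p2 p4 z := by
  ext i
  fin_cases i <;>
    simp [gens, W, fam, tfun, sfun, tl_mk, Matrix.trace_fin_two] <;>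
    first
      | (simp [mk])
      | (field_simp; try ring)

/-- Rescaled `s13`. -/
noncomputable def ha (w : Fin 12 → ℂ) (z : ℂ) : ℂ := 1 + w 4 / 2 * (w 6 / 2) * z ^ 2
/-- The value of `s24`. -/
noncomputable def hb (w : Fin 12 → ℂ) (p2 p4 z : ℂ) : ℂ :=
  2 * p2 * p4 + (w 9 * w 11 + w 10 * w 8) * z

/-- Rescaled values of the family `e`. -/
noncomputable def h (w : Fin 12 → ℂ) (p2 p4 z : ℂ) : Idx → ℂ
  | .one => 1
  | .ab => ha w z * hb w p2 p4 z
  | .pw false k => ha w z ^ (k + 1)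
  | .pw true k => hb w p2 p4 z ^ (k + 1)
  | .pm false k => ha w z ^ (k + 2) * hb w p2 p4 z
  | .pm true k => hb w p2 p4 z ^ (k + 2) * ha w z
  | .d1 false k => ha w z ^ k * (-p2 * (1 - w 4 / 2 * (w 6 / 2) * z ^ 2))
  | .d1 true k => hb w p2 p4 z ^ k *
      (p2 * (w 6 / 2 * (w 11 * z) - w 10) + p4 * (w 9 - w 8 * z * (w 6 / 2)))
  | .d2 false k => ha w z ^ k * (p4 * (1 - w 4 / 2 * (w 6 / 2) * z ^ 2))
  | .d2 true k => hb w p2 p4 z ^ k *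
      (-(p2 * w 11 - p4 * w 8) + w 4 / 2 * z * (p2 * w 10 - w 9 * p4))

lemma a_fam (w : Fin 12 → ℂ) (p2 p4 z : ℂ) (hz : z ≠ 0) :
    z * sfun 0 2 (fam w p2 p4 z) = ha w z := by
  simp [fam, sfun, tl_mk, Matrix.trace_fin_two, ha]
  field_simp

lemma b_fam (w : Fin 12 → ℂ) (p2 p4 z : ℂ) :
    sfun 1 3 (fam w p2 p4 z) = hb w p2 p4 z := by
  simp [fam, sfun, tl_mk, Matrix.trace_fin_two, hb]
  ring

lemma d012_fam (w : Fin 12 → ℂ) (p2 p4 z : ℂ) (hz : z ≠ 0) :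
    z * sfun3 0 1 2 (fam w p2 p4 z) = -p2 * (1 - w 4 / 2 * (w 6 / 2) * z ^ 2) := by
  simp [fam, sfun3, tl_mk, Matrix.trace_fin_two]
  field_simp
  ring

lemma d023_fam (w : Fin 12 → ℂ) (p2 p4 z : ℂ) (hz : z ≠ 0) :
    z * sfun3 0 2 3 (fam w p2 p4 z) = p4 * (1 - w 4 / 2 * (w 6 / 2) * z ^ 2) := by
  simp [fam, sfun3, tl_mk, Matrix.trace_fin_two]
  field_simp
  ring

lemma d123_fam (w : Fin 12 → ℂ) (p2 p4 z : ℂ) :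
    sfun3 1 2 3 (fam w p2 p4 z) =
      p2 * (w 6 / 2 * (w 11 * z) - w 10) + p4 * (w 9 - w 8 * z * (w 6 / 2)) := by
  simp [fam, sfun3, tl_mk, Matrix.trace_fin_two]
  ring

lemma d013_fam (w : Fin 12 → ℂ) (p2 p4 z : ℂ) (hz : z ≠ 0) :
    sfun3 0 1 3 (fam w p2 p4 z) =
      -(p2 * w 11 - p4 * w 8) + w 4 / 2 * z * (p2 * w 10 - w 9 * p4) := by
  simp [fam, sfun3, tl_mk, Matrix.trace_fin_two]
  field_simp
  ring

lemma e_fam (w : Fin 12 → ℂ) (p2 p4 z : ℂ) (hz : z ≠ 0) (i : Idx) :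
    z ^ adeg i * e i (fam w p2 p4 z) = h w p2 p4 z i := by
  rcases i with _ | _ | ⟨_ | _, k⟩ | ⟨_ | _, k⟩ | ⟨_ | _, k⟩ | ⟨_ | _, k⟩ <;>
    simp only [adeg, e, h, Pi.mul_apply, Pi.pow_apply, Pi.one_apply, ← a_fam w p2 p4 z hz,
      ← b_fam w p2 p4 z, ← d012_fam w p2 p4 z hz, ← d023_fam w p2 p4 z hz,
      ← d123_fam w p2 p4 z, ← d013_fam w p2 p4 z hz] <;> ring

lemma h_cont (w : Fin 12 → ℂ) (p2 p4 : ℂ) (i : Idx) :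
    Continuous fun z => h w p2 p4 z i := by
  rcases i with _ | _ | ⟨_ | _, k⟩ | ⟨_ | _, k⟩ | ⟨_ | _, k⟩ | ⟨_ | _, k⟩ <;>
    simp only [h, ha, hb] <;> fun_prop

lemma W_cont (w : Fin 12 → ℂ) (p2 p4 : ℂ) : Continuous fun z => W w p2 p4 z := by
  refine continuous_pi fun i => ?_
  fin_cases i <;> simp [W] <;> fun_prop

lemma W_zero (w : Fin 12 → ℂ) (p2 p4 : ℂ) (h2 : 2 * p2 ^ 2 = w 5) (h4 : 2 * p4 ^ 2 = w 7) :
    W w p2 p4 0 = w := by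
  ext i
  fin_cases i <;> simp [W, h2, h4]

/-- Leading term extraction. -/
lemma lead (s : Finset Idx) (p : Idx → MvPolynomial (Fin 12) ℂ)
    (hsum : ∀ x, ∑ i ∈ s, MvPolynomial.eval (gens x) (p i) * e i x = 0)
    (N : ℕ) (hN : ∀ i ∈ s, N < adeg i → p i = 0)
    (w : Fin 12 → ℂ) (p2 p4 : ℂ) (h2 : 2 * p2 ^ 2 = w 5) (h4 : 2 * p4 ^ 2 = w 7) :
    ∑ i ∈ s, (if adeg i = N then MvPolynomial.eval w (p i) * h w p2 p4 0 i else 0) = 0 := by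
  set F : ℂ → ℂ := fun z => ∑ i ∈ s,
    MvPolynomial.eval (W w p2 p4 z) (p i) * (z ^ (N - adeg i) * h w p2 p4 z i) with hF
  have hFc : Continuous F := by
    refine continuous_finsetSum _ fun i _ => ?_
    refine Continuous.mul ?_ (Continuous.mul (by fun_prop) (h_cont w p2 p4 i))
    exact (MvPolynomial.continuous_eval (p i)).comp (W_cont w p2 p4)
  have hF0 : ∀ z, z ≠ 0 → F z = 0 := by
    intro z hz
    have := hsum (fam w p2 p4 z)
    rw [gens_fam w p2 p4 z hz] at this
    have h3 : F z = z ^ N * ∑ i ∈ s, MvPolynomial.eval (W w p2 p4 z) (p i) *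
        e i (fam w p2 p4 z) := by
      rw [Finset.mul_sum]
      refine Finset.sum_congr rfl fun i hi => ?_
      by_cases hd : N < adeg i
      · simp [hN i hi hd]
      · rw [← e_fam w p2 p4 z hz]
        have : z ^ N = z ^ (N - adeg i) * z ^ adeg i := by
          rw [← pow_add]; congr 1; omega
        rw [this]; ring
    rw [h3, this, mul_zero]
  have hFz : F = fun _ => 0 :=
    Continuous.ext_on (dense_compl_singleton (0 : ℂ)) hFc continuous_const
      (fun z hz => hF0 z (by simpa using hz))
  have this : F 0 = 0 := congrFun hFz 0
  refine Eq.trans ?_ this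
  simp only [hF]
  refine Finset.sum_congr rfl fun i hi => ?_
  rw [W_zero w p2 p4 h2 h4]
  split_ifs with hd
  · simp [hd]
  · by_cases hd' : N < adeg i
    · simp [hN i hi hd']
    · rw [zero_pow (by omega)]; simp

lemma poly_zero (p : MvPolynomial (Fin 12) ℂ)
    (hp : ∀ w : Fin 12 → ℂ, w 5 ≠ 0 → w 7 ≠ 0 → MvPolynomial.eval w p = 0) : p = 0 := by
  have : p * (MvPolynomial.X 5 * MvPolynomial.X 7) = 0 := by
    refine MvPolynomial.funext fun w => ?_
    by_cases h5 : w 5 = 0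
    · simp [h5]
    by_cases h7 : w 7 = 0
    · simp [h7]
    simp [hp w h5 h7]
  rcases mul_eq_zero.mp this with h | h
  · exact h
  · simp [MvPolynomial.X_ne_zero] at h

/-- The mixed monomial of degree `M+1`. -/
def mix : ℕ → Idx
  | 0 => .ab
  | M + 1 => .pm false M

lemma exists_sqrt (c : ℂ) : ∃ q : ℂ, 2 * q ^ 2 = c := by
  obtain ⟨q, hq⟩ := IsAlgClosed.exists_pow_nat_eq (c / 2) (n := 2) (by norm_num)
  exact ⟨q, by rw [hq]; ring⟩

lemma kill (s : Finset Idx) (p : Idx → MvPolynomial (Fin 12) ℂ)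
    (hsum : ∀ x, ∑ i ∈ s, MvPolynomial.eval (gens x) (p i) * e i x = 0)
    (hout : ∀ i ∉ s, p i = 0)
    (M : ℕ) (hN : ∀ i, M + 1 < adeg i → p i = 0)
    (hM : M = 0 → ∀ k, p (.pm true k) = 0) :
    ∀ i, adeg i = M + 1 → p i = 0 := by
  classical
  have key : ∀ (w : Fin 12 → ℂ) (p2 p4 : ℂ), 2 * p2 ^ 2 = w 5 → 2 * p4 ^ 2 = w 7 →
      MvPolynomial.eval w (p (.pw false M)) + 2 * p2 * p4 * MvPolynomial.eval w (p (mix M))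
      - p2 * MvPolynomial.eval w (p (.d1 false M))
      + p4 * MvPolynomial.eval w (p (.d2 false M)) = 0 := by
    intro w p2 p4 h2 h4
    have h0 := lead s p hsum (M + 1) (fun i _ => hN i) w p2 p4 h2 h4
    set c : Idx → ℂ := fun i =>
      if adeg i = M + 1 then MvPolynomial.eval w (p i) * h w p2 p4 0 i else 0 with hc
    let T : Finset Idx := {.pw false M, mix M, .d1 false M, .d2 false M}
    have e1 : ∑ i ∈ s, c i = ∑ i ∈ s ∪ T, c i := by
      refine Finset.sum_subset Finset.subset_union_left fun i _ hi => ?_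
      simp [hc, hout i hi]
    have e2 : ∑ i ∈ T, c i = ∑ i ∈ s ∪ T, c i := by
      refine Finset.sum_subset Finset.subset_union_right fun i _ hi => ?_
      simp only [T, Finset.mem_insert, Finset.mem_singleton, not_or] at hi
      simp only [hc]
      split_ifs with hd
      · rcases i with _ | _ | ⟨_ | _, k⟩ | ⟨_ | _, k⟩ | ⟨_ | _, k⟩ | ⟨_ | _, k⟩ <;>
          simp only [adeg] at hd
        · omega
        · obtain rfl : M = 0 := by omega
          simp [mix] at hi
        · obtain rfl : k = M := by omega
          simp at hi
        · omega
        · obtain rfl : M = k + 1 := by omega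
          simp [mix] at hi
        · simp [hM (by omega) k]
        · obtain rfl : k = M := by omega
          simp at hi
        · omega
        · obtain rfl : k = M := by omega
          simp at hi
        · omega
      · rfl
    change ∑ i ∈ s, c i = 0 at h0
    rw [e1, ← e2] at h0
    have e3 : ∑ i ∈ T, c i = c (.pw false M) + c (mix M) + c (.d1 false M) + c (.d2 false M) := by
      simp only [T]
      rw [Finset.sum_insert, Finset.sum_insert, Finset.sum_insert, Finset.sum_singleton]
      · ring
      all_goals cases M <;> simp [mix]
    rw [e3] at h0
    have cm : c (mix M) = MvPolynomial.eval w (p (mix M)) * (2 * p2 * p4) := by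
      cases M <;> simp [hc, mix, adeg, h, ha, hb]
    rw [cm] at h0
    simp [hc, adeg, h, ha] at h0
    linear_combination h0
  have fin : p (.pw false M) = 0 ∧ p (mix M) = 0 ∧ p (.d1 false M) = 0 ∧ p (.d2 false M) = 0 := by
    refine ⟨?_, ?_, ?_, ?_⟩ <;>
    · refine poly_zero _ fun w h5 h7 => ?_
      obtain ⟨p2, h2⟩ := exists_sqrt (w 5)
      obtain ⟨p4, h4⟩ := exists_sqrt (w 7)
      have n2 : p2 ≠ 0 := by rintro rfl; apply h5; rw [← h2]; simp
      have n4 : p4 ≠ 0 := by rintro rfl; apply h7; rw [← h4]; simp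
      have k1 := key w p2 p4 h2 h4
      have k2 := key w (-p2) p4 (by rw [← h2]; ring) h4
      have k3 := key w p2 (-p4) h2 (by rw [← h4]; ring)
      have k4 := key w (-p2) (-p4) (by rw [← h2]; ring) (by rw [← h4]; ring)
      first
        | linear_combination (k1 + k2 + k3 + k4) / 4
        | (refine (mul_eq_zero.mp ?_).resolve_left (mul_ne_zero n2 n4)
           linear_combination (k1 - k2 - k3 + k4) / 8)
        | (refine (mul_eq_zero.mp ?_).resolve_left n2
           linear_combination (-k1 + k2 - k3 + k4) / 4)
        | (refine (mul_eq_zero.mp ?_).resolve_left n4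
           linear_combination (k1 + k2 - k3 - k4) / 4)
  intro i hd
  obtain ⟨f1, f2, f3, f4⟩ := fin
  rcases i with _ | _ | ⟨_ | _, k⟩ | ⟨_ | _, k⟩ | ⟨_ | _, k⟩ | ⟨_ | _, k⟩ <;>
    simp only [adeg] at hd
  · omega
  · obtain rfl : M = 0 := by omega
    exact f2
  · obtain rfl : k = M := by omega
    exact f1
  · omega
  · obtain rfl : M = k + 1 := by omega
    exact f2
  · exact hM (by omega) k
  · obtain rfl : k = M := by omega
    exact f3
  · omega
  · obtain rfl : k = M := by omega
    exact f4
  · omega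

/-- All coefficients of elements of pole order at least two vanish. -/
lemma kill_ge_two (s : Finset Idx) (p : Idx → MvPolynomial (Fin 12) ℂ)
    (hsum : ∀ x, ∑ i ∈ s, MvPolynomial.eval (gens x) (p i) * e i x = 0)
    (hout : ∀ i ∉ s, p i = 0) : ∀ i, 2 ≤ adeg i → p i = 0 := by
  have main : ∀ d M : ℕ, s.sup adeg ≤ M + d → ∀ i, M + 1 < adeg i → p i = 0 := by
    intro d
    induction d with
    | zero =>
      intro M hM i hi
      refine hout i fun his => ?_
      have := Finset.le_sup (f := adeg) his
      omega
    | succ d ih =>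
      intro M hM i hi
      have h1 := ih (M + 1) (by omega)
      by_cases hd : adeg i = M + 1 + 1
      · exact kill s p hsum hout (M + 1) h1 (by omega) i hd
      · exact h1 i (by omega)
  intro i hi
  exact main (s.sup adeg) 0 (by omega) i (by omega)

/-- The action on indices of the cyclic shift. -/
def sh : Idx → Idx
  | .one => .one
  | .ab => .ab
  | .pw s k => .pw (!s) k
  | .pm s k => .pm (!s) k
  | .d1 false k => .d1 true k
  | .d1 true k => .d2 false k
  | .d2 false k => .d2 true k
  | .d2 true k => .d1 false k

lemma sh_four (i : Idx) : sh (sh (sh (sh i))) = i := by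
  rcases i with _ | _ | ⟨_ | _, k⟩ | ⟨_ | _, k⟩ | ⟨_ | _, k⟩ | ⟨_ | _, k⟩ <;> rfl

/-- The cyclic shift of a quadruple. -/
def rot (x : Fin 4 → M2) : Fin 4 → M2 := fun i => x (i + 1)

lemma sfun_comm (i j : Fin 4) (x : Fin 4 → M2) : sfun i j x = sfun j i x := by
  simp only [sfun]; exact Matrix.trace_mul_comm _ _

lemma sfun3_cyc (i j k : Fin 4) (x : Fin 4 → M2) : sfun3 i j k x = sfun3 k i j x := by
  simp only [sfun3]; rw [Matrix.trace_mul_comm, mul_assoc]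

lemma sfun_rot (i j : Fin 4) (x : Fin 4 → M2) : sfun i j (rot x) = sfun (i + 1) (j + 1) x := rfl
lemma sfun3_rot (i j k : Fin 4) (x : Fin 4 → M2) :
    sfun3 i j k (rot x) = sfun3 (i + 1) (j + 1) (k + 1) x := rfl

lemma e_rot (i : Idx) (x : Fin 4 → M2) : e i (rot x) = e (sh i) x := by
  have h1 : sfun 0 2 (rot x) = sfun 1 3 x := rfl
  have h2 : sfun 1 3 (rot x) = sfun 0 2 x := sfun_comm 2 0 x
  have h3 : sfun3 0 1 2 (rot x) = sfun3 1 2 3 x := rfl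
  have h4 : sfun3 1 2 3 (rot x) = sfun3 0 2 3 x := sfun3_cyc 2 3 0 x
  have h5 : sfun3 0 2 3 (rot x) = sfun3 0 1 3 x := (sfun3_cyc 0 1 3 x).symm ▸
    (sfun3_cyc 1 3 0 x).trans (sfun3_cyc 0 1 3 x)
  have h6 : sfun3 0 1 3 (rot x) = sfun3 0 1 2 x := sfun3_cyc 1 2 0 x
  rcases i with _ | _ | ⟨_ | _, k⟩ | ⟨_ | _, k⟩ | ⟨_ | _, k⟩ | ⟨_ | _, k⟩ <;>
    simp only [e, sh, Pi.mul_apply, Pi.pow_apply, Pi.one_apply, h1, h2, h3, h4, h5, h6,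
      Bool.not_true, Bool.not_false]
  ring

/-- The cyclic shift as a permutation of the indices. -/
def shE : Idx ≃ Idx where
  toFun := sh
  invFun i := sh (sh (sh i))
  left_inv := sh_four
  right_inv := sh_four

/-- Action of the shift on the generators. -/
def rho : Fin 12 → Fin 12 := ![1, 2, 3, 0, 5, 6, 7, 4, 9, 10, 11, 8]

lemma gens_rot (x : Fin 4 → M2) : gens (rot x) = gens x ∘ rho := by
  ext i
  fin_cases i <;> simp only [gens, rho, Function.comp] <;>
  first
    | rfl
    | exact sfun_comm _ _ x

lemma rho_inj : Function.Injective rho := by decide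

lemma all_zero (s : Finset Idx) (p : Idx → MvPolynomial (Fin 12) ℂ)
    (hsum : ∀ x, ∑ i ∈ s, MvPolynomial.eval (gens x) (p i) * e i x = 0)
    (hout : ∀ i ∉ s, p i = 0) : ∀ i, p i = 0 := by
  classical
  let s' : Finset Idx := s.map shE.toEmbedding
  let p' : Idx → MvPolynomial (Fin 12) ℂ := fun i => MvPolynomial.rename rho (p (shE.symm i))
  have hp' : ∀ i, p' (sh i) = 0 → p i = 0 := by
    intro i hi
    have h1 : shE.symm (sh i) = i := shE.symm_apply_apply i
    simp only [p', h1] at hi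
    exact MvPolynomial.rename_injective rho rho_inj (by simpa using hi)
  have hp2 : ∀ i, p i = 0 → p' (sh i) = 0 := by
    intro i hi
    have h1 : shE.symm (sh i) = i := shE.symm_apply_apply i
    simp [p', h1, hi]
  have hsum' : ∀ x, ∑ i ∈ s', MvPolynomial.eval (gens x) (p' i) * e i x = 0 := by
    intro x
    rw [Finset.sum_map, ← hsum (rot x)]
    refine Finset.sum_congr rfl fun i _ => ?_
    have h1 : shE.symm (shE i) = i := shE.symm_apply_apply i
    rw [gens_rot, e_rot]
    simp only [p', Equiv.coe_toEmbedding, h1, MvPolynomial.eval_rename]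
    rfl
  have hout' : ∀ i ∉ s', p' i = 0 := by
    intro i hi
    have : shE.symm i ∉ s := fun hh => hi (by
      simp only [s', Finset.mem_map_equiv]; exact hh)
    simp [p', hout _ this]
  have A := kill_ge_two s p hsum hout
  have A' := kill_ge_two s' p' hsum' hout'
  have B := kill s p hsum hout 0 (fun i hi => A i hi)
    (fun _ k => hp' _ (A' _ (by simp [sh, adeg])))
  have B' := kill s' p' hsum' hout' 0 (fun i hi => A' i hi)
    (fun _ k => hp2 (.pm false k) (A _ (by simp [adeg])))
  have C : ∀ i, i ≠ .one → p i = 0 := by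
    intro i hi
    by_cases hd : adeg i = 0
    · have hd' : 1 ≤ adeg (sh i) := by
        rcases i with _ | _ | ⟨_ | _, k⟩ | ⟨_ | _, k⟩ | ⟨_ | _, k⟩ | ⟨_ | _, k⟩ <;>
          simp [adeg, sh] at hd hi ⊢
      by_cases hd2 : adeg (sh i) = 0 + 1
      · exact hp' i (B' _ hd2)
      · exact hp' i (A' _ (by omega))
    · by_cases hd2 : adeg i = 0 + 1
      · exact B _ hd2
      · exact A _ (by omega)
  have D : p .one = 0 := by
    refine poly_zero _ fun w h5 h7 => ?_
    obtain ⟨p2, h2⟩ := exists_sqrt (w 5)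
    obtain ⟨p4, h4⟩ := exists_sqrt (w 7)
    have h0 := lead s p hsum 0 (fun i _ hi => C i (by rintro rfl; simp [adeg] at hi))
      w p2 p4 h2 h4
    by_cases hs : Idx.one ∈ s
    · rw [Finset.sum_eq_single_of_mem Idx.one hs (fun i _ hi => by simp [C i hi])] at h0
      simpa [adeg, h] using h0
    · simp [hout _ hs]
  intro i
  by_cases hi : i = .one
  · rw [hi]; exact D
  · exact C i hi

theorem e_indep : LinearIndependent Ralg e := by
  classical
  rw [linearIndependent_iff']
  intro s g hg i hi
  choose q hq using fun i => exists_poly (g i).2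
  have := all_zero s (fun j => if j ∈ s then q j else 0) (by
    intro x
    have h1 := congrFun hg x
    rw [Finset.sum_apply] at h1
    rw [← show (0 : (Fin 4 → M2) → ℂ) x = 0 from rfl, ← h1]
    refine Finset.sum_congr rfl fun j hj => ?_
    simp only [hj, if_true, ← hq]
    rfl) (fun j hj => by simp [hj]) i
  simp only [hi, if_true] at this
  ext x
  rw [hq i x, this]
  simp

lemma Eset_sub : Eset ⊆ Set.range e := by
  rintro f ((hf | ⟨k, hk, hf⟩) | ⟨k, hf⟩)
  · simp only [Set.mem_insert_iff, Set.mem_singleton_iff] at hf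
    rcases hf with rfl | rfl | rfl | rfl
    · exact ⟨.one, rfl⟩
    · exact ⟨.pw false 0, by simp [e]⟩
    · exact ⟨.pw true 0, by simp [e]⟩
    · exact ⟨.ab, rfl⟩
  · obtain ⟨m, rfl⟩ : ∃ m, k = m + 2 := ⟨k - 2, by omega⟩
    rcases hf with rfl | rfl | rfl | rfl
    · exact ⟨.pw false (m + 1), rfl⟩
    · exact ⟨.pm false m, rfl⟩
    · exact ⟨.pw true (m + 1), rfl⟩
    · exact ⟨.pm true m, rfl⟩
  · rcases hf with rfl | rfl | rfl | rfl
    · exact ⟨.d1 false k, rfl⟩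
    · exact ⟨.d2 false k, rfl⟩
    · exact ⟨.d2 true k, rfl⟩
    · exact ⟨.d1 true k, rfl⟩

end EIndep

/-- The family `E` of functions on `M₂(ℂ)⁴` is linearly independent over `R`. -/
theorem stmt_3 :
    LinearIndependent Ralg ((↑) : Eset → ((Fin 4 → M2) → ℂ)) := by
  exact (EIndep.e_indep.linearIndepOn_id).mono EIndep.Eset_sub
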